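/- arXiv:1911.05947 — 6 statements merged into one kernel-verified Lean document; each statement's English description precedes it below -/
import Mathlib

section
/- Let M be a multilayer network with node set V, v̂ ∈ V an evader, F ⊆ V\{v̂} a set of contacts such that no edge of M joins an occurrence of v̂ and an occurrence of a contact, and such that every contact occurs together with v̂ in at least one layer. Let d ∈ ℕ and k ∈ ℕ with k ≤ |F|. Then there exists an admissible edge set A joining v̂ to exactly k contacts (each in at least one layer) such that in M̂ = (V_L, E_L ∪ A, V, L) at least d nodes have global degree centrality strictly greater than that of v̂, if and only if min(k, |{v ∈ F : c_degr(M,v) = k + c_degr(M,v̂)}|) + |{v ∈ V : c_degr(M,v) > k + c_degr(M,v̂)}| ≥ d. -/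
open scoped Classical ENNReal

/-- A multilayer network: `occ v α` means node `v` occurs in layer `α`;
`Edge` is the edge relation on occurrences. -/
structure MLNet (V : Type*) (L : Type*) where
  occ : V → L → Prop
  Edge : V × L → V × L → Prop

namespace MLNet

variable {V : Type*} {L : Type*}

/-- The axioms of a multilayer network with diagonal couplings: the edge relation is
symmetric, has no self-loops, joins only occurrences, and inter-layer edges join
two occurrences of the same node. -/
def IsValid (M : MLNet V L) : Prop :=
  (∀ a b, M.Edge a b → M.Edge b a) ∧
  (∀ a, ¬ M.Edge a a) ∧
  (∀ a b, M.Edge a b → M.occ a.1 a.2 ∧ M.occ b.1 b.2) ∧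
  (∀ a b, M.Edge a b → a.2 ≠ b.2 → a.1 = b.1)

/-- The simple graph on occurrences given by the (symmetrized) edge relation. -/
def flat (M : MLNet V L) : SimpleGraph (V × L) := SimpleGraph.fromRel M.Edge

/-- Global degree centrality: the number of nodes `w ≠ v` such that some edge joins an
occurrence of `v` and an occurrence of `w`. -/
noncomputable def degGlobal (M : MLNet V L) (v : V) : ℕ :=
  {w : V | w ≠ v ∧ ∃ α β, M.Edge (v, α) (w, β) ∨ M.Edge (w, β) (v, α)}.ncard

/-- Multilayer distance: the least length of a path from an occurrence of `v` to an
occurrence of `w` (`⊤` if there is none). -/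
noncomputable def mdist (M : MLNet V L) (v w : V) : ℕ∞ :=
  ⨅ (α : L) (β : L) (_ : M.occ v α) (_ : M.occ w β), M.flat.edist (v, α) (w, β)

/-- Global closeness centrality, valued in `ℝ≥0∞` (so that `1/∞ = 0`). -/
noncomputable def closGlobal (M : MLNet V L) [Fintype V] (v : V) : ℝ≥0∞ :=
  ∑ w ∈ Finset.univ.filter (fun w => w ≠ v), ((M.mdist v w : ℝ≥0∞))⁻¹

variable [Fintype V] [Fintype L]

/-- The number of shortest multilayer paths between nodes `w` and `u`
(`0` if they are not connected). -/
noncomputable def numSP (M : MLNet V L) (w u : V) : ℕ :=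
  ∑ α : L, ∑ β : L,
    if M.occ w α ∧ M.occ u β then
      (M.flat.finsetWalkLength (M.mdist w u).toNat (w, α) (u, β)).card
    else 0

/-- The number of pairs `(v^γ, p)` where `p` is a shortest multilayer path between `w` and `u`
passing through the occurrence `v^γ`. -/
noncomputable def numSPthrough (M : MLNet V L) (v w u : V) : ℕ :=
  ∑ α : L, ∑ β : L,
    if M.occ w α ∧ M.occ u β then
      ∑ p ∈ M.flat.finsetWalkLength (M.mdist w u).toNat (w, α) (u, β),
        (Finset.univ.filter (fun γ : L => (v, γ) ∈ p.support)).card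
    else 0

/-- Global betweenness centrality: the sum over unordered pairs `{w,u}` of connected nodes
(distinct from `v`) of the fraction of shortest multilayer paths passing through an
occurrence of `v` (division by zero, for unconnected pairs, gives `0`). -/
noncomputable def betwGlobal (M : MLNet V L) (v : V) : ℝ :=
  (1 / 2) * ∑ w : V, ∑ u : V,
    if w ≠ v ∧ u ≠ v ∧ w ≠ u then (M.numSPthrough v w u : ℝ) / (M.numSP w u : ℝ) else 0

/-- The simple graph `G^α` of a single layer (nodes not occurring in `α` are isolated). -/
def layerGraph (M : MLNet V L) (α : L) : SimpleGraph V :=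
  SimpleGraph.fromRel (fun v w => M.Edge (v, α) (w, α))

/-- Degree of a node in the graph of layer `α`. -/
noncomputable def layerDeg (M : MLNet V L) (α : L) (v : V) : ℕ :=
  ((M.layerGraph α).neighborSet v).ncard

end MLNet

/-- `Admissible M ve F A`: `A` encodes a set of intra-layer edges joining the evader `ve`
to contacts; `(v, α) ∈ A` encodes the edge `(ve^α, v^α)`, which requires `v ∈ F` and
both `ve` and `v` to occur in layer `α`. -/
def Admissible {V L : Type*} (M : MLNet V L) (ve : V) (F : Set V) (A : Set (V × L)) : Prop :=
  ∀ p ∈ A, p.1 ∈ F ∧ M.occ ve p.2 ∧ M.occ p.1 p.2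

/-- The network obtained from `M` by adding, for each `(v, α) ∈ A`, the edge `(ve^α, v^α)`. -/
def MLNet.addEdges {V L : Type*} (M : MLNet V L) (ve : V) (A : Set (V × L)) : MLNet V L where
  occ := M.occ
  Edge a b := M.Edge a b ∨
    ∃ p ∈ A, (a = (ve, p.2) ∧ b = (p.1, p.2)) ∨ (b = (ve, p.2) ∧ a = (p.1, p.2))

/-- `A` joins the evader to every contact in at least one layer. -/
def ConnectsAll {V L : Type*} (F : Set V) (A : Set (V × L)) : Prop :=
  ∀ v ∈ F, ∃ α, (v, α) ∈ A

section SG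

variable {V : Type*} [Fintype V]

/-- Closeness centrality in a simple graph, valued in `ℝ≥0∞` (so that `1/∞ = 0`). -/
noncomputable def closSG (G : SimpleGraph V) (v : V) : ℝ≥0∞ :=
  ∑ w ∈ Finset.univ.filter (fun w => w ≠ v), ((G.edist v w : ℝ≥0∞))⁻¹

/-- The number of shortest paths between `w` and `u` in a simple graph
(`0` if they are not connected and distinct). -/
noncomputable def numSPsg (G : SimpleGraph V) (w u : V) : ℕ :=
  (G.finsetWalkLength (G.edist w u).toNat w u).card

/-- The number of shortest paths between `w` and `u` passing through `v`. -/
noncomputable def numSPsgThrough (G : SimpleGraph V) (v w u : V) : ℕ :=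
  ((G.finsetWalkLength (G.edist w u).toNat w u).filter (fun p => v ∈ p.support)).card

/-- Betweenness centrality in a simple graph: the sum over unordered pairs `{w,u}` of
connected vertices distinct from `v` of the fraction of shortest paths through `v`. -/
noncomputable def betwSG (G : SimpleGraph V) (v : V) : ℝ :=
  (1 / 2) * ∑ w : V, ∑ u : V,
    if w ≠ v ∧ u ≠ v ∧ w ≠ u then (numSPsgThrough G v w u : ℝ) / (numSPsg G w u : ℝ) else 0

end SG

namespace MLNet

variable {V L : Type*} {M : MLNet V L} {ve : V} {F : Set V} {A : Set (V × L)}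

/-- The nodes other than `v` that are joined to `v` by some edge. -/
def globalNbrs (M : MLNet V L) (v : V) : Set V :=
  {w : V | w ≠ v ∧ ∃ α β, M.Edge (v, α) (w, β) ∨ M.Edge (w, β) (v, α)}

theorem degGlobal_eq_ncard_globalNbrs (M : MLNet V L) (v : V) :
    M.degGlobal v = (M.globalNbrs v).ncard := rfl

theorem mem_globalNbrs_addEdges {v w : V} :
    w ∈ (M.addEdges ve A).globalNbrs v ↔
      w ∈ M.globalNbrs v ∨
        (w ≠ v ∧ ((v = ve ∧ ∃ α, (w, α) ∈ A) ∨ (w = ve ∧ ∃ α, (v, α) ∈ A))) := by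
  simp only [globalNbrs, addEdges, Set.mem_ofPred_eq]
  constructor
  · rintro ⟨hne, α, β, (h | ⟨p, hp, h⟩) | (h | ⟨p, hp, h⟩)⟩
    · exact Or.inl ⟨hne, α, β, Or.inl h⟩
    · grind
    · exact Or.inl ⟨hne, α, β, Or.inr h⟩
    · grind
  · rintro (⟨hne, α, β, h⟩ | ⟨hne, ⟨rfl, α, h⟩ | ⟨rfl, α, h⟩⟩)
    · exact ⟨hne, α, β, h.imp Or.inl Or.inl⟩
    · exact ⟨hne, α, α, Or.inl (Or.inr ⟨_, h, Or.inl ⟨rfl, rfl⟩⟩)⟩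
    · exact ⟨hne, α, α, Or.inl (Or.inr ⟨_, h, Or.inr ⟨rfl, rfl⟩⟩)⟩

theorem degGlobal_addEdges_of_notMem {v : V} (hne : v ≠ ve) (hv : ¬ ∃ α, (v, α) ∈ A) :
    (M.addEdges ve A).degGlobal v = M.degGlobal v := by
  have hset : (M.addEdges ve A).globalNbrs v = M.globalNbrs v := by
    ext w
    rw [mem_globalNbrs_addEdges]
    grind
  rw [degGlobal_eq_ncard_globalNbrs, hset, degGlobal_eq_ncard_globalNbrs]

variable [Finite V]

theorem degGlobal_addEdges_evader (hF : ve ∉ F)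
    (hnoedge : ∀ v ∈ F, ∀ α β, ¬ (M.Edge (ve, α) (v, β) ∨ M.Edge (v, β) (ve, α)))
    (hA : Admissible M ve F A) :
    (M.addEdges ve A).degGlobal ve = {v : V | ∃ α, (v, α) ∈ A}.ncard + M.degGlobal ve := by
  have hset : (M.addEdges ve A).globalNbrs ve = {v : V | ∃ α, (v, α) ∈ A} ∪ M.globalNbrs ve := by
    ext w
    rw [mem_globalNbrs_addEdges, Set.mem_union, Set.mem_ofPred_eq]
    constructor
    · rintro (h | ⟨hne, ⟨-, h⟩ | ⟨h, -⟩⟩)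
      exacts [Or.inr h, Or.inl h, absurd h hne]
    · rintro (⟨α, h⟩ | h)
      · exact Or.inr ⟨ne_of_mem_of_not_mem (hA _ h).1 hF, Or.inl ⟨rfl, α, h⟩⟩
      · exact Or.inl h
  rw [degGlobal_eq_ncard_globalNbrs, hset, Set.ncard_union_eq, degGlobal_eq_ncard_globalNbrs]
  rw [Set.disjoint_left]
  rintro w ⟨α, h⟩ ⟨-, β, γ, h'⟩
  exact hnoedge w (hA _ h).1 β γ h'

theorem degGlobal_addEdges_of_mem (hF : ve ∉ F)
    (hnoedge : ∀ v ∈ F, ∀ α β, ¬ (M.Edge (ve, α) (v, β) ∨ M.Edge (v, β) (ve, α)))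
    (hA : Admissible M ve F A) {v : V} (hv : ∃ α, (v, α) ∈ A) :
    (M.addEdges ve A).degGlobal v = M.degGlobal v + 1 := by
  obtain ⟨α, hα⟩ := hv
  have hvF : v ∈ F := (hA _ hα).1
  have hne : ve ≠ v := (ne_of_mem_of_not_mem hvF hF).symm
  have hset : (M.addEdges ve A).globalNbrs v = insert ve (M.globalNbrs v) := by
    ext w
    rw [mem_globalNbrs_addEdges, Set.mem_insert_iff]
    grind
  rw [degGlobal_eq_ncard_globalNbrs, hset, Set.ncard_insert_of_notMem,
    degGlobal_eq_ncard_globalNbrs]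
  rintro ⟨-, β, γ, h⟩
  exact hnoedge v hvF γ β h.symm

/-- The nodes ranked strictly above the evader after adding `A` are those that already exceed
the evader's new degree, and the new neighbours whose degree was equal to it. -/
theorem ncard_degGlobal_addEdges_lt (hF : ve ∉ F)
    (hnoedge : ∀ v ∈ F, ∀ α β, ¬ (M.Edge (ve, α) (v, β) ∨ M.Edge (v, β) (ve, α)))
    (hA : Admissible M ve F A) {k : ℕ} (hk : {v : V | ∃ α, (v, α) ∈ A}.ncard = k) :
    {u : V | (M.addEdges ve A).degGlobal ve < (M.addEdges ve A).degGlobal u}.ncard =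
      ({v : V | ∃ α, (v, α) ∈ A} ∩ {v : V | v ∈ F ∧ M.degGlobal v = k + M.degGlobal ve}).ncard +
        {v : V | k + M.degGlobal ve < M.degGlobal v}.ncard := by
  rw [← Set.ncard_union_eq]
  · congr 1
    ext u
    have hve := degGlobal_addEdges_evader hF hnoedge hA
    rw [hk] at hve
    simp only [Set.mem_union, Set.mem_inter_iff, Set.mem_ofPred_eq, hve]
    by_cases hu : ∃ α, (u, α) ∈ A
    · have huF : u ∈ F := hu.elim fun α h => (hA _ h).1
      rw [degGlobal_addEdges_of_mem hF hnoedge hA hu]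
      simp only [hu, huF, true_and]
      omega
    · simp only [hu, false_and, false_or]
      by_cases hne : u = ve
      · subst hne
        rw [hve]
        omega
      · rw [degGlobal_addEdges_of_notMem hne hu]
  · rw [Set.disjoint_left]
    intro u hu hlt
    have h : M.degGlobal u = k + M.degGlobal ve := hu.2.2
    have h' : k + M.degGlobal ve < M.degGlobal u := hlt
    omega

end MLNet

theorem Set.exists_subset_ncard_eq_min_le_ncard_inter {V : Type*} [Finite V] {E F : Set V}
    (hEF : E ⊆ F) {k : ℕ} (hk : k ≤ F.ncard) :
    ∃ S ⊆ F, S.ncard = k ∧ min k E.ncard ≤ (S ∩ E).ncard := by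
  rcases le_total k E.ncard with h | h
  · obtain ⟨S, hSE, hS⟩ := Set.exists_subset_card_eq h
    refine ⟨S, hSE.trans hEF, hS, ?_⟩
    rw [Set.inter_eq_left.2 hSE, hS]
    exact min_le_left _ _
  · obtain ⟨S, hES, hSF, hS⟩ := Set.exists_subsuperset_card_eq hEF h hk
    refine ⟨S, hSF, hS, ?_⟩
    rw [Set.inter_eq_right.2 hES]
    exact min_le_right _ _

/-- Characterization of when the evader can be joined to exactly `k`
contacts while at least `d` nodes have strictly greater global degree centrality. -/
theorem global_degree_hiding_characterization
    {V L : Type*} [Fintype V] [Fintype L]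
    (M : MLNet V L) (hM : M.IsValid) (ve : V) (F : Set V) (hF : ve ∉ F)
    (hnoedge : ∀ v ∈ F, ∀ α β, ¬ (M.Edge (ve, α) (v, β) ∨ M.Edge (v, β) (ve, α)))
    (hocc : ∀ v ∈ F, ∃ α, M.occ ve α ∧ M.occ v α)
    (d k : ℕ) (hk : k ≤ F.ncard) :
    (∃ A : Set (V × L), Admissible M ve F A ∧
        {v : V | ∃ α, (v, α) ∈ A}.ncard = k ∧
        d ≤ {u : V | (M.addEdges ve A).degGlobal ve < (M.addEdges ve A).degGlobal u}.ncard)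
    ↔ d ≤ min k ({v : V | v ∈ F ∧ M.degGlobal v = k + M.degGlobal ve}.ncard) +
          {v : V | k + M.degGlobal ve < M.degGlobal v}.ncard := by
  constructor
  · rintro ⟨A, hA, hcard, hd⟩
    rw [MLNet.ncard_degGlobal_addEdges_lt hF hnoedge hA hcard] at hd
    refine hd.trans (Nat.add_le_add_right (le_min ?_ ?_) _)
    · exact hcard ▸ Set.ncard_le_ncard Set.inter_subset_left
    · exact Set.ncard_le_ncard Set.inter_subset_right
  · intro hd
    obtain ⟨S, hSF, hS, hmin⟩ := Set.exists_subset_ncard_eq_min_le_ncard_inter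
      (E := {v : V | v ∈ F ∧ M.degGlobal v = k + M.degGlobal ve}) (fun _ h => h.1) hk
    let A : Set (V × L) := {p | p.1 ∈ S ∧ M.occ ve p.2 ∧ M.occ p.1 p.2}
    have hA : Admissible M ve F A := fun p hp => ⟨hSF hp.1, hp.2⟩
    have hAS : {v : V | ∃ α, (v, α) ∈ A} = S := by
      ext v
      exact ⟨fun ⟨_, h⟩ => h.1, fun h => (hocc v (hSF h)).imp fun _ hα => ⟨h, hα⟩⟩
    have hcard : {v : V | ∃ α, (v, α) ∈ A}.ncard = k := hAS ▸ hS
    refine ⟨A, hA, hcard, ?_⟩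
    rw [MLNet.ncard_degGlobal_addEdges_lt hF hnoedge hA hcard, hAS]
    exact hd.trans (Nat.add_le_add_right hmin _)
end

section
/- Consider an instance of the Maximum Multilayer Local Hiding problem with degree centrality: a multilayer network M, an evader v̂, contacts F ⊆ V\{v̂}, and a safety margin d^α for every layer α. Call an admissible edge set A a feasible solution if, in the resulting network, for every layer α at least d^α nodes of V^α have degree in layer α strictly greater than that of v̂; call A irredundant if it joins each contact to v̂ in at most one layer. The greedy algorithm processes the layers in a fixed order and in each layer joins v̂ to a maximum-cardinality set of contacts, occurring in that layer and not yet joined to v̂, subject to keeping at least d^α nodes with strictly greater degree than v̂ in that layer. Then for every irredundant feasible solution A* and every output A$ of the greedy algorithm, the number of contacts joined to v̂ by A* is at most twice the number of contacts joined to v̂ by A$; i.e., the greedy algorithm is a 2-approximation. -/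
open scoped Classical ENNReal

namespace Greedy

variable {V : Type*} {L : Type*} [Fintype V] [Fintype L]

/-- The set of evader edges consisting of joining the contacts in `T` within layer `α`
only. -/
def layerSet (T : Finset V) (α : L) : Set (V × L) := {p | p.2 = α ∧ p.1 ∈ T}

/-- The evader `ve` is hidden in layer `α`: at least `d α` nodes occurring in `α` have
degree in the graph of layer `α` strictly greater than that of `ve`. -/
def LayerHidden (M : MLNet V L) (d : L → ℕ) (ve : V) (α : L) : Prop :=
  d α ≤ {z : V | M.occ z α ∧ M.layerDeg α ve < M.layerDeg α z}.ncard

/-- A feasible solution of Maximum Multilayer Local Hiding with degree centrality: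
an admissible edge set keeping the evader hidden in every layer. -/
def Feasible (M : MLNet V L) (ve : V) (F : Set V) (d : L → ℕ) (A : Set (V × L)) : Prop :=
  Admissible M ve F A ∧ ∀ α : L, LayerHidden (M.addEdges ve A) d ve α

/-- `A` joins each contact to the evader in at most one layer. -/
def Irredundant (A : Set (V × L)) : Prop :=
  ∀ v : V, ∀ α β : L, (v, α) ∈ A → (v, β) ∈ A → α = β

/-- The contacts available to the greedy algorithm when it reaches layer `α` (processing
layers in the order given by `e`, with per-layer choices `g`): contacts occurring in `α`
(together with the evader) that were not joined to the evader in an earlier layer. -/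
def Available (M : MLNet V L) (ve : V) (F : Set V) (e : Fin (Fintype.card L) ≃ L)
    (g : L → Finset V) (α : L) : Set V :=
  {v | v ∈ F ∧ M.occ ve α ∧ M.occ v α ∧ ∀ β : L, e.symm β < e.symm α → v ∉ g β}

/-- `g` records a run of the greedy algorithm with layer order `e`: in each layer `α` it
joins the evader to a maximum-cardinality set of available contacts subject to keeping the
evader hidden in that layer. -/
def IsGreedyOutput (M : MLNet V L) (ve : V) (F : Set V) (d : L → ℕ)
    (e : Fin (Fintype.card L) ≃ L) (g : L → Finset V) : Prop :=
  ∀ α : L,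
    ↑(g α) ⊆ Available M ve F e g α ∧
    LayerHidden (M.addEdges ve (layerSet (g α) α)) d ve α ∧
    ∀ T : Finset V, ↑T ⊆ Available M ve F e g α →
      LayerHidden (M.addEdges ve (layerSet T α)) d ve α → T.card ≤ (g α).card

/-- The set of contacts joined to the evader by an edge set. -/
def joinedBy (A : Set (V × L)) : Set V := {v | ∃ α, (v, α) ∈ A}

/-- The edge set output by the greedy algorithm with per-layer choices `g`. -/
def Aof (g : L → Finset V) : Set (V × L) := {p | p.1 ∈ g p.2}

end Greedy

/-- If `G'` arises from `G` by adding edges incident to `v`, then a vertex whose degree exceeds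
that of `v` in `G'` already has larger degree than `v` in `G`. -/
theorem SimpleGraph.ncard_neighborSet_lt_of_le {V : Type*} [Finite V] {G G' : SimpleGraph V}
    {v z : V} (hle : G ≤ G')
    (hnew : ∀ x y, G'.Adj x y → x ≠ v → y ≠ v → G.Adj x y)
    (h : (G'.neighborSet v).ncard < (G'.neighborSet z).ncard) :
    (G.neighborSet v).ncard < (G.neighborSet z).ncard := by
  have hzv : z ≠ v := by
    rintro rfl
    exact lt_irrefl _ h
  have hsub : G.neighborSet v ⊆ G'.neighborSet v := fun _ hx => hle hx
  by_cases hz : G'.Adj z v ∧ ¬ G.Adj z v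
  · have hv : (G.neighborSet v).ncard < (G'.neighborSet v).ncard :=
      Set.ncard_lt_ncard ((Set.ssubset_iff_of_subset hsub).2
        ⟨z, hz.1.symm, fun hadj => hz.2 hadj.symm⟩)
    have hins : G'.neighborSet z ⊆ insert v (G.neighborSet z) := fun x hx =>
      (eq_or_ne x v).imp id fun hxv => hnew z x hx hzv hxv
    have h1 := Set.ncard_le_ncard hins
    have h2 := Set.ncard_insert_le v (G.neighborSet z)
    omega
  · have hz' : G'.neighborSet z ⊆ G.neighborSet z := fun x hx => by
      rcases eq_or_ne x v with rfl | hxv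
      · by_contra hadj
        exact hz ⟨hx, hadj⟩
      · exact hnew z x hx hzv hxv
    exact (Set.ncard_le_ncard hsub).trans_lt (h.trans_le (Set.ncard_le_ncard hz'))

namespace MLNet

variable {V : Type*} {L : Type*}

theorem layerGraph_addEdges_mono (M : MLNet V L) (ve : V) {A B : Set (V × L)} (hAB : A ⊆ B)
    (α : L) : (M.addEdges ve A).layerGraph α ≤ (M.addEdges ve B).layerGraph α := by
  have hedge : ∀ a b, (M.addEdges ve A).Edge a b → (M.addEdges ve B).Edge a b := fun _ _ =>
    Or.imp id fun ⟨p, hp, h⟩ => ⟨p, hAB hp, h⟩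
  exact fun _ _ h => ⟨h.1, h.2.imp (hedge _ _) (hedge _ _)⟩

theorem layerGraph_addEdges_adj_of_ne (M : MLNet V L) {ve : V} (A B : Set (V × L)) {α : L}
    {x y : V} (h : ((M.addEdges ve B).layerGraph α).Adj x y) (hx : x ≠ ve) (hy : y ≠ ve) :
    ((M.addEdges ve A).layerGraph α).Adj x y := by
  have hedge : ∀ a b : V × L, a.1 ≠ ve → b.1 ≠ ve → (M.addEdges ve B).Edge a b →
      (M.addEdges ve A).Edge a b := by
    rintro a b ha hb (h | ⟨p, -, ⟨rfl, -⟩ | ⟨rfl, -⟩⟩)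
    · exact Or.inl h
    · exact absurd rfl ha
    · exact absurd rfl hb
  exact ⟨h.1, h.2.imp (hedge _ _ hx hy) (hedge _ _ hy hx)⟩

end MLNet

namespace Greedy

/-- Hiding in a layer is inherited by smaller sets of added evader edges. -/
theorem LayerHidden.anti {V : Type*} {L : Type*} [Fintype V] {M : MLNet V L}
    {d : L → ℕ} {ve : V} {α : L} {A B : Set (V × L)} (hAB : A ⊆ B)
    (h : LayerHidden (M.addEdges ve B) d ve α) : LayerHidden (M.addEdges ve A) d ve α :=
  le_trans h <| Set.ncard_le_ncard fun _ hz => ⟨hz.1,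
    SimpleGraph.ncard_neighborSet_lt_of_le (M.layerGraph_addEdges_mono ve hAB α)
      (fun _ _ hxy => M.layerGraph_addEdges_adj_of_ne A B hxy) hz.2⟩

variable {V : Type*} {L : Type*} [Fintype L] {M : MLNet V L} {ve : V} {F : Set V}
  {d : L → ℕ} {e : Fin (Fintype.card L) ≃ L} {g : L → Finset V}

/-- The greedy algorithm joins the evader to each contact in at most one layer. -/
theorem IsGreedyOutput.disjoint [Fintype V] (hg : IsGreedyOutput M ve F d e g) {α β : L} (hαβ : α ≠ β) :
    Disjoint (g α) (g β) := by
  rw [Finset.disjoint_left]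
  intro v hα hβ
  rcases lt_or_gt_of_ne (e.symm.injective.ne hαβ) with h | h
  · exact ((hg β).1 hβ).2.2.2 α h hα
  · exact ((hg α).1 hα).2.2.2 β h hβ

/-- In each layer, a feasible solution joins at most as many contacts missed by the greedy
algorithm as the greedy algorithm joins in that layer. -/
theorem IsGreedyOutput.card_filter_le [Fintype V] (hg : IsGreedyOutput M ve F d e g) {A : Set (V × L)}
    (hA : Feasible M ve F d A) (α : L) :
    (Finset.univ.filter fun v => (v, α) ∈ A ∧ ∀ β, v ∉ g β).card ≤ (g α).card := by
  refine (hg α).2.2 _ (fun v hv => ?_) (LayerHidden.anti ?_ (hA.2 α))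
  · obtain ⟨hvA, hvg⟩ := (Finset.mem_filter.1 hv).2
    obtain ⟨hvF, hocc, hocc'⟩ := hA.1 _ hvA
    exact ⟨hvF, hocc, hocc', fun β _ => hvg β⟩
  · rintro ⟨v, _⟩ ⟨rfl, hv⟩
    exact (Finset.mem_filter.1 hv).2.1

end Greedy

/-- The greedy algorithm is a `2`-approximation for Maximum Multilayer
Local Hiding with degree centrality: every irredundant feasible solution joins the evader
to at most twice as many contacts as any output of the greedy algorithm. -/
theorem greedy_two_approximation
    {V : Type*} {L : Type*} [Fintype V] [Fintype L]
    (M : MLNet V L) (hM : M.IsValid) (ve : V) (F : Set V) (hF : ve ∉ F)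
    (d : L → ℕ) (e : Fin (Fintype.card L) ≃ L) (g : L → Finset V)
    (hg : Greedy.IsGreedyOutput M ve F d e g)
    (A : Set (V × L)) (hA : Greedy.Feasible M ve F d A) (hirr : Greedy.Irredundant A) :
    (Greedy.joinedBy A).ncard ≤ 2 * (Greedy.joinedBy (Greedy.Aof g)).ncard := by
  let R : L → Finset V := fun α => Finset.univ.filter fun v => (v, α) ∈ A ∧ ∀ β, v ∉ g β
  have hJ : Greedy.joinedBy (Greedy.Aof g) = ↑(Finset.univ.biUnion g) := by
    ext v
    simp [Greedy.joinedBy, Greedy.Aof]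
  have hcard : (Finset.univ.biUnion g).card = ∑ α, (g α).card :=
    Finset.card_biUnion fun _ _ _ _ h => hg.disjoint h
  have hsub : Greedy.joinedBy A ⊆ ↑(Finset.univ.biUnion g ∪ Finset.univ.biUnion R) := by
    rintro v ⟨α, hα⟩
    by_cases hv : ∃ β, v ∈ g β
    · simp [hv]
    · push Not at hv
      have hR : ∃ α, v ∈ R α := ⟨α, Finset.mem_filter.2 ⟨Finset.mem_univ v, hα, hv⟩⟩
      simp [hR]
  have hR : (Finset.univ.biUnion R).card ≤ ∑ α, (g α).card :=
    Finset.card_biUnion_le.trans (Finset.sum_le_sum fun α _ => hg.card_filter_le hA α)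
  have hle := Set.ncard_le_ncard hsub
  have hunion := Finset.card_union_le (Finset.univ.biUnion g) (Finset.univ.biUnion R)
  rw [Set.ncard_coe_finset] at hle
  rw [hJ, Set.ncard_coe_finset]
  omega
end

section
/- There exists an instance of the Maximum Multilayer Local Hiding problem with degree centrality (a multilayer network M, evader v̂, contacts F, and safety margins d^α), a layer order, and an output A$ of the greedy algorithm for that order, such that some feasible solution joins v̂ to exactly twice as many contacts as A$ does. Hence the 2-approximation bound for the greedy algorithm is tight. -/
open scoped Classical ENNReal

namespace Greedy

section Decidable

variable {V L : Type*}

/-- Adjacency in layer `α` after the evader edges `A` have been added. -/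
def AdjAfter (M : MLNet V L) (ve : V) (A : Set (V × L)) (α : L) (v w : V) : Prop :=
  v ≠ w ∧ ((M.Edge (v, α) (w, α) ∨ (v = ve ∧ (w, α) ∈ A) ∨ (w = ve ∧ (v, α) ∈ A)) ∨
    (M.Edge (w, α) (v, α) ∨ (w = ve ∧ (v, α) ∈ A) ∨ (v = ve ∧ (w, α) ∈ A)))

theorem addEdges_edge_iff (M : MLNet V L) (ve : V) (A : Set (V × L)) (α : L) (v w : V) :
    (M.addEdges ve A).Edge (v, α) (w, α) ↔
      M.Edge (v, α) (w, α) ∨ (v = ve ∧ (w, α) ∈ A) ∨ (w = ve ∧ (v, α) ∈ A) := by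
  simp only [MLNet.addEdges, Prod.mk.injEq]
  refine or_congr_right ⟨?_, ?_⟩
  · rintro ⟨⟨x, β⟩, hA, ⟨⟨rfl, rfl⟩, rfl, -⟩ | ⟨⟨rfl, rfl⟩, rfl, -⟩⟩
    · exact Or.inl ⟨rfl, hA⟩
    · exact Or.inr ⟨rfl, hA⟩
  · rintro (⟨rfl, hA⟩ | ⟨rfl, hA⟩)
    · exact ⟨_, hA, Or.inl ⟨⟨rfl, rfl⟩, rfl, rfl⟩⟩
    · exact ⟨_, hA, Or.inr ⟨⟨rfl, rfl⟩, rfl, rfl⟩⟩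

theorem layerDeg_addEdges [Fintype V] [Fintype L] (M : MLNet V L) (ve : V) (A : Set (V × L))
    (α : L) (v : V) [DecidablePred (AdjAfter M ve A α v)] :
    (M.addEdges ve A).layerDeg α v = (Finset.univ.filter (AdjAfter M ve A α v)).card := by
  rw [MLNet.layerDeg, ← Set.ncard_coe_finset]
  congr 1
  ext w
  simp only [SimpleGraph.mem_neighborSet, MLNet.layerGraph, SimpleGraph.fromRel_adj,
    addEdges_edge_iff, Finset.coe_filter, Finset.mem_univ, true_and, Set.mem_ofPred_eq, AdjAfter]

theorem layerHidden_addEdges_iff [Fintype V] [Fintype L] (M : MLNet V L) (d : L → ℕ) (ve : V)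
    (A : Set (V × L)) (α : L) [∀ v, DecidablePred (AdjAfter M ve A α v)]
    [∀ v, Decidable (M.occ v α)] :
    LayerHidden (M.addEdges ve A) d ve α ↔
      d α ≤ (Finset.univ.filter fun z => M.occ z α ∧
        (Finset.univ.filter (AdjAfter M ve A α ve)).card <
          (Finset.univ.filter (AdjAfter M ve A α z)).card).card := by
  rw [LayerHidden, ← Set.ncard_coe_finset]
  simp only [layerDeg_addEdges, Finset.coe_filter, Finset.mem_univ, true_and]
  rfl

instance [DecidableEq V] [DecidableEq L] (M : MLNet V L) (ve : V) (A : Set (V × L)) (α : L)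
    (v : V) [DecidableRel M.Edge] [DecidablePred (· ∈ A)] :
    DecidablePred (AdjAfter M ve A α v) := fun w =>
  haveI : ∀ p, Decidable (p ∈ A) := fun p => inferInstanceAs (Decidable ((· ∈ A) p))
  inferInstanceAs (Decidable (v ≠ w ∧
    ((M.Edge (v, α) (w, α) ∨ (v = ve ∧ (w, α) ∈ A) ∨ (w = ve ∧ (v, α) ∈ A)) ∨
      (M.Edge (w, α) (v, α) ∨ (w = ve ∧ (v, α) ∈ A) ∨ (v = ve ∧ (w, α) ∈ A)))))

instance [DecidableEq V] [DecidableEq L] (T : Finset V) (α : L) :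
    DecidablePred (· ∈ layerSet T α) := fun p =>
  inferInstanceAs (Decidable (p.2 = α ∧ p.1 ∈ T))

instance [DecidableEq V] (g : L → Finset V) : DecidablePred (· ∈ Aof g) := fun p =>
  inferInstanceAs (Decidable (p.1 ∈ g p.2))

end Decidable

/-- The evader `0`, the contacts `1` and `2`, and the node `3`. Layer `0` contains all four nodes
and the edges `13` and `23`; layer `1` contains only `0`, `1`, `3` and the edge `13`. -/
def tightNet : MLNet (Fin 4) (Fin 2) where
  occ v α := α = 1 → v ≠ 2
  Edge a b := a.2 = b.2 ∧ ((a.1 = 3 ∧ (b.1 = 1 ∨ b.1 = 2 ∧ b.2 = 0)) ∨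
    (b.1 = 3 ∧ (a.1 = 1 ∨ a.1 = 2 ∧ a.2 = 0)))

instance : DecidableRel tightNet.Edge := fun a b =>
  inferInstanceAs (Decidable (a.2 = b.2 ∧ ((a.1 = 3 ∧ (b.1 = 1 ∨ b.1 = 2 ∧ b.2 = 0)) ∨
    (b.1 = 3 ∧ (a.1 = 1 ∨ a.1 = 2 ∧ a.2 = 0)))))

instance (v : Fin 4) (α : Fin 2) : Decidable (tightNet.occ v α) :=
  inferInstanceAs (Decidable (α = 1 → v ≠ 2))

/-- The greedy algorithm joins the evader to contact `1` in layer `0`. -/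
def tightGreedy : Fin 2 → Finset (Fin 4) := ![{1}, ∅]

/-- An optimal solution: contact `2` is joined in layer `0` and contact `1` in layer `1`. -/
def tightOpt : Fin 2 → Finset (Fin 4) := ![{2}, {1}]

theorem tightNet_isValid : tightNet.IsValid := by
  unfold MLNet.IsValid
  decide

theorem tightNet_layerHidden_iff (A : Set (Fin 4 × Fin 2)) (α : Fin 2)
    [DecidablePred (· ∈ A)] :
    LayerHidden (tightNet.addEdges 0 A) (fun _ => 1) 0 α ↔
      1 ≤ (Finset.univ.filter fun z => tightNet.occ z α ∧
        (Finset.univ.filter (AdjAfter tightNet 0 A α 0)).card <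
          (Finset.univ.filter (AdjAfter tightNet 0 A α z)).card).card :=
  layerHidden_addEdges_iff ..

theorem tightNet_feasible_greedy :
    Feasible tightNet 0 {1, 2} (fun _ => 1) (Aof tightGreedy) := by
  refine ⟨?_, fun α => ?_⟩
  · change ∀ p : Fin 4 × Fin 2, p.1 ∈ tightGreedy p.2 →
      (p.1 = 1 ∨ p.1 = 2) ∧ tightNet.occ 0 p.2 ∧ tightNet.occ p.1 p.2
    decide
  · rw [tightNet_layerHidden_iff]
    revert α
    decide

theorem tightNet_feasible_opt :
    Feasible tightNet 0 {1, 2} (fun _ => 1) (Aof tightOpt) := by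
  refine ⟨?_, fun α => ?_⟩
  · change ∀ p : Fin 4 × Fin 2, p.1 ∈ tightOpt p.2 →
      (p.1 = 1 ∨ p.1 = 2) ∧ tightNet.occ 0 p.2 ∧ tightNet.occ p.1 p.2
    decide
  · rw [tightNet_layerHidden_iff]
    revert α
    decide

theorem tightNet_isGreedyOutput :
    IsGreedyOutput tightNet 0 {1, 2} (fun _ => 1) (finCongr (Fintype.card_fin 2)) tightGreedy := by
  have available_iff : ∀ v α, v ∈ Available tightNet 0 {1, 2}
      (finCongr (Fintype.card_fin 2)) tightGreedy α ↔ α = 0 ∧ (v = 1 ∨ v = 2) := by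
    change ∀ (v : Fin 4) (α : Fin 2), ((v = 1 ∨ v = 2) ∧ tightNet.occ 0 α ∧ tightNet.occ v α ∧
      ∀ β : Fin 2, β < α → v ∉ tightGreedy β) ↔ α = 0 ∧ (v = 1 ∨ v = 2)
    decide
  intro α
  simp only [Set.subset_def, Finset.mem_coe, available_iff, tightNet_layerHidden_iff]
  revert α
  decide

theorem joinedBy_Aof {V L : Type*} [Fintype L] [DecidableEq V] (g : L → Finset V) :
    joinedBy (Aof g) = ↑(Finset.univ.biUnion g) := by
  ext v
  simp [joinedBy, Aof]

end Greedy

/-- The `2`-approximation bound for the greedy algorithm is tight: there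
is an instance of Maximum Multilayer Local Hiding with degree centrality, a layer order,
and a greedy output joining the evader to a positive number of contacts, together with a
feasible solution joining the evader to exactly twice as many contacts. -/
theorem greedy_two_approximation_tight :
    ∃ (nV nL : ℕ) (M : MLNet (Fin nV) (Fin nL)) (ve : Fin nV) (F : Set (Fin nV))
      (d : Fin nL → ℕ) (e : Fin (Fintype.card (Fin nL)) ≃ Fin nL)
      (g : Fin nL → Finset (Fin nV)) (A : Set (Fin nV × Fin nL)),
      M.IsValid ∧ ve ∉ F ∧
      Greedy.IsGreedyOutput M ve F d e g ∧
      Greedy.Feasible M ve F d (Greedy.Aof g) ∧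
      Greedy.Feasible M ve F d A ∧
      0 < (Greedy.joinedBy (Greedy.Aof g)).ncard ∧
      (Greedy.joinedBy A).ncard = 2 * (Greedy.joinedBy (Greedy.Aof g)).ncard := by
  have hg : (Greedy.joinedBy (Greedy.Aof Greedy.tightGreedy)).ncard = 1 := by
    rw [Greedy.joinedBy_Aof, Set.ncard_coe_finset]
    decide
  have ho : (Greedy.joinedBy (Greedy.Aof Greedy.tightOpt)).ncard = 2 := by
    rw [Greedy.joinedBy_Aof, Set.ncard_coe_finset]
    decide
  exact ⟨4, 2, Greedy.tightNet, 0, {1, 2}, fun _ => 1, finCongr (Fintype.card_fin 2),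
    Greedy.tightGreedy, Greedy.Aof Greedy.tightOpt, Greedy.tightNet_isValid, by simp,
    Greedy.tightNet_isGreedyOutput, Greedy.tightNet_feasible_greedy,
    Greedy.tightNet_feasible_opt, by rw [hg]; exact one_pos, by rw [hg, ho]⟩
end

section
/- Let G=(V,E) be a simple graph and v ∈ V. Then the betweenness centrality of v equals 0 if and only if every two distinct neighbours of v are adjacent to each other, i.e., the neighbourhood of v forms a clique. -/
open scoped Classical ENNReal

/-- If the neighbourhood of `v` is a clique, a walk with `v` as an internal vertex is not
a shortest one. -/
theorem SimpleGraph.Walk.dist_lt_length_of_mem_support {V : Type*} {G : SimpleGraph V} {v w u : V}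
    (h : ∀ x y, G.Adj v x → G.Adj v y → x ≠ y → G.Adj x y) (hw : w ≠ v) (hu : u ≠ v)
    (p : G.Walk w u) (hv : v ∈ p.support) : G.dist w u < p.length := by
  obtain ⟨q, r, rfl⟩ := SimpleGraph.Walk.mem_support_iff_exists_append.mp hv
  obtain ⟨x, hx, q', hq⟩ : ∃ x, G.Adj v x ∧ ∃ q' : G.Walk x w, q.length = q'.length + 1 := by
    rw [← q.length_reverse]
    cases q.reverse with
    | nil => exact absurd rfl hw
    | cons hx q' => exact ⟨_, hx, q', rfl⟩
  cases r with
  | nil => exact absurd rfl hu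
  | @cons _ y _ hy r' =>
    rw [SimpleGraph.Walk.length_append, SimpleGraph.Walk.length_cons, hq]
    by_cases hxy : x = y
    · subst hxy
      have := SimpleGraph.dist_le (q'.reverse.append r')
      rw [SimpleGraph.Walk.length_append, SimpleGraph.Walk.length_reverse] at this
      omega
    · have := SimpleGraph.dist_le (q'.reverse.append (.cons (h x y hx hy hxy) r'))
      rw [SimpleGraph.Walk.length_append, SimpleGraph.Walk.length_reverse,
        SimpleGraph.Walk.length_cons] at this
      omega

theorem SimpleGraph.dist_eq_two_of_adj_of_adj {V : Type*} {G : SimpleGraph V} {v w u : V}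
    (hw : G.Adj v w) (hu : G.Adj v u) (hwu : w ≠ u) (hn : ¬ G.Adj w u) : G.dist w u = 2 := by
  let p : G.Walk w u := .cons hw.symm (.cons hu .nil)
  have hle : G.dist w u ≤ 2 := SimpleGraph.dist_le p
  have hpos : 0 < G.dist w u := p.reachable.pos_dist_of_ne hwu
  have hone : G.dist w u ≠ 1 := fun h => hn (SimpleGraph.dist_eq_one_iff_adj.mp h)
  omega

theorem numSPsgThrough_eq_zero_iff {V : Type*} [Fintype V] (G : SimpleGraph V) (v w u : V) :
    numSPsgThrough G v w u = 0 ↔ ∀ p : G.Walk w u, p.length = G.dist w u → v ∉ p.support := by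
  simp only [numSPsgThrough, Finset.card_eq_zero, Finset.filter_eq_empty_iff,
    SimpleGraph.mem_finsetWalkLength_iff, SimpleGraph.dist]

theorem numSPsgThrough_le_numSPsg {V : Type*} [Fintype V] (G : SimpleGraph V) (v w u : V) :
    numSPsgThrough G v w u ≤ numSPsg G w u :=
  Finset.card_filter_le _ _

theorem betwSG_eq_zero_iff {V : Type*} [Fintype V] (G : SimpleGraph V) (v : V) :
    betwSG G v = 0 ↔ ∀ w u, w ≠ v → u ≠ v → w ≠ u → numSPsgThrough G v w u = 0 := by
  have hnonneg : ∀ w u : V, (0 : ℝ) ≤ if w ≠ v ∧ u ≠ v ∧ w ≠ u then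
      (numSPsgThrough G v w u : ℝ) / (numSPsg G w u : ℝ) else 0 := by
    intro w u
    split_ifs <;> positivity
  rw [betwSG, mul_eq_zero_iff_left (by norm_num),
    Finset.sum_eq_zero_iff_of_nonneg fun w _ => Finset.sum_nonneg fun u _ => hnonneg w u]
  refine forall_congr' fun w => ?_
  rw [Finset.sum_eq_zero_iff_of_nonneg fun u _ => hnonneg w u]
  simp only [Finset.mem_univ, true_imp_iff]
  refine forall_congr' fun u => ?_
  rw [ite_eq_right_iff, and_imp, and_imp]
  refine imp_congr_right fun _ => imp_congr_right fun _ => imp_congr_right fun _ => ?_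
  rw [div_eq_zero_iff, Nat.cast_eq_zero, Nat.cast_eq_zero]
  have := numSPsgThrough_le_numSPsg G v w u
  omega

/-- The betweenness centrality of `v` is zero if and only if the
neighbourhood of `v` forms a clique. -/
theorem betweenness_eq_zero_iff_neighborhood_clique
    {V : Type*} [Fintype V] (G : SimpleGraph V) (v : V) :
    betwSG G v = 0 ↔ ∀ w u, G.Adj v w → G.Adj v u → w ≠ u → G.Adj w u := by
  rw [betwSG_eq_zero_iff]
  simp only [numSPsgThrough_eq_zero_iff]
  constructor
  · intro h w u hw hu hwu
    by_contra hn
    refine h w u hw.ne' hu.ne' hwu (.cons hw.symm (.cons hu .nil)) ?_ (by simp)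
    rw [SimpleGraph.dist_eq_two_of_adj_of_adj hw hu hwu hn]
    rfl
  · intro h w u hw hu _ p hp hv
    exact (p.dist_lt_length_of_mem_support h hw hu hv).ne' hp
end

section
/- Let n ≥ 1 and let G be the complete bipartite graph K_{2,n} with parts {h_1,h_2} and {c_1,…,c_n} (edges exactly {c_i,h_1} and {c_i,h_2} for all i ≤ n). Then the betweenness centrality of every vertex c_i equals 1/n, and the betweenness centrality of each of h_1 and h_2 equals n(n−1)/4. -/
open scoped Classical ENNReal

/-- The complete bipartite graph `K_{2,n}` with parts `{h₁, h₂}` (the `inl` vertices) and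
`{c₁, …, cₙ}` (the `inr` vertices). -/
def K2n (n : ℕ) : SimpleGraph (Fin 2 ⊕ Fin n) :=
  SimpleGraph.fromRel (fun x y => ∃ (h : Fin 2) (c : Fin n), x = Sum.inl h ∧ y = Sum.inr c)

/-- Walks of length two from `w` to `u` are determined by their middle vertex. -/
theorem card_filter_finsetWalkLength_two {V : Type*} [Fintype V] (G : SimpleGraph V) (w u : V)
    (P : V → Prop) :
    ((G.finsetWalkLength 2 w u).filter (fun p => P (p.getVert 1))).card =
      (Finset.univ.filter (fun x => (G.Adj w x ∧ G.Adj x u) ∧ P x)).card := by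
  refine Finset.card_bij (fun p _ => p.getVert 1) ?_ ?_ ?_
  · intro p hp
    simp only [Finset.mem_filter, SimpleGraph.mem_finsetWalkLength_iff, Finset.mem_univ,
      true_and] at hp ⊢
    obtain ⟨hl, hP⟩ := hp
    match p, hl, hP with
    | .cons h (.cons h' .nil), _, hP => exact ⟨⟨h, h'⟩, hP⟩
  · intro p hp q hq hpq
    simp only [Finset.mem_filter, SimpleGraph.mem_finsetWalkLength_iff] at hp hq
    obtain ⟨hl, -⟩ := hp
    obtain ⟨hl', -⟩ := hq
    match p, hl, q, hl', hpq with
    | .cons h (.cons h' .nil), _, .cons k (.cons k' .nil), _, hpq =>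
      simp at hpq
      subst hpq
      rfl
  · intro x hx
    simp only [Finset.mem_filter, Finset.mem_univ, true_and] at hx
    exact ⟨.cons hx.1.1 (.cons hx.1.2 .nil), by
      simpa [SimpleGraph.mem_finsetWalkLength_iff] using hx.2, rfl⟩

theorem edist_toNat_eq_two {V : Type*} {G : SimpleGraph V} {w u x : V} (hne : w ≠ u)
    (hadj : ¬ G.Adj w u) (hwx : G.Adj w x) (hxu : G.Adj x u) : (G.edist w u).toNat = 2 := by
  have hle : G.dist w u ≤ 2 :=
    SimpleGraph.dist_le (.cons hwx (.cons hxu .nil))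
  have hr : G.Reachable w u := ⟨.cons hwx (.cons hxu .nil)⟩
  have h0 : G.dist w u ≠ 0 := fun h => hne (hr.dist_eq_zero_iff.1 h)
  have h1 : G.dist w u ≠ 1 := fun h => hadj (SimpleGraph.dist_eq_one_iff_adj.1 h)
  change G.dist w u = 2
  omega

theorem numSPsg_of_common_neighbor {V : Type*} [Fintype V] {G : SimpleGraph V} {w u x : V}
    (hne : w ≠ u) (hadj : ¬ G.Adj w u) (hwx : G.Adj w x) (hxu : G.Adj x u) :
    numSPsg G w u = (Finset.univ.filter (fun y => G.Adj w y ∧ G.Adj y u)).card := by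
  unfold numSPsg
  rw [edist_toNat_eq_two hne hadj hwx hxu]
  simpa using card_filter_finsetWalkLength_two G w u (fun _ => True)

theorem numSPsgThrough_of_common_neighbor {V : Type*} [Fintype V] {G : SimpleGraph V}
    {v w u x : V} (hvw : v ≠ w) (hvu : v ≠ u)
    (hne : w ≠ u) (hadj : ¬ G.Adj w u) (hwx : G.Adj w x) (hxu : G.Adj x u) :
    numSPsgThrough G v w u = if G.Adj w v ∧ G.Adj v u then 1 else 0 := by
  unfold numSPsgThrough
  rw [edist_toNat_eq_two hne hadj hwx hxu]
  have hsupp : (G.finsetWalkLength 2 w u).filter (fun p => v ∈ p.support) =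
      (G.finsetWalkLength 2 w u).filter (fun p => p.getVert 1 = v) := by
    refine Finset.filter_congr fun p hp => ?_
    rw [SimpleGraph.mem_finsetWalkLength_iff] at hp
    match p, hp with
    | .cons h (.cons h' .nil), _ => simp [hvw, hvu, eq_comm]
  rw [hsupp, card_filter_finsetWalkLength_two G w u (fun y => y = v)]
  split_ifs with h
  · rw [Finset.card_eq_one]
    refine ⟨v, ?_⟩
    ext y
    simp only [Finset.mem_filter, Finset.mem_univ, true_and, Finset.mem_singleton]
    exact ⟨fun hy => hy.2, by rintro rfl; exact ⟨h, rfl⟩⟩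
  · rw [Finset.card_eq_zero, Finset.filter_eq_empty_iff]
    rintro y - ⟨hy, rfl⟩
    exact h hy

theorem numSPsgThrough_of_adj {V : Type*} [Fintype V] {G : SimpleGraph V} {v w u : V}
    (hvw : v ≠ w) (hvu : v ≠ u) (hadj : G.Adj w u) : numSPsgThrough G v w u = 0 := by
  have hd : (G.edist w u).toNat = 1 := SimpleGraph.dist_eq_one_iff_adj.2 hadj
  unfold numSPsgThrough
  rw [hd, Finset.card_eq_zero, Finset.filter_eq_empty_iff]
  intro p hp
  rw [SimpleGraph.mem_finsetWalkLength_iff] at hp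
  match p, hp with
  | .cons h .nil, _ => simp [hvw, hvu]

namespace K2n

variable {n : ℕ}

@[simp]
theorem adj_inl_inr (h : Fin 2) (c : Fin n) : (K2n n).Adj (Sum.inl h) (Sum.inr c) :=
  ⟨by simp, .inl ⟨h, c, rfl, rfl⟩⟩

@[simp]
theorem adj_inr_inl (h : Fin 2) (c : Fin n) : (K2n n).Adj (Sum.inr c) (Sum.inl h) :=
  (adj_inl_inr h c).symm

@[simp]
theorem not_adj_inl_inl (h k : Fin 2) : ¬ (K2n n).Adj (Sum.inl h) (Sum.inl k) := by
  simp [K2n]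

@[simp]
theorem not_adj_inr_inr (c d : Fin n) : ¬ (K2n n).Adj (Sum.inr c) (Sum.inr d) := by
  simp [K2n]

theorem numSPsg_inl_inl (hn : 1 ≤ n) {h k : Fin 2} (hne : h ≠ k) :
    numSPsg (K2n n) (Sum.inl h) (Sum.inl k) = n := by
  rw [numSPsg_of_common_neighbor (x := Sum.inr ⟨0, hn⟩) (by simpa using hne) (by simp)
    (by simp) (by simp), Finset.card_filter, Fintype.sum_sum_type]
  simp

theorem numSPsg_inr_inr {c d : Fin n} (hne : c ≠ d) :
    numSPsg (K2n n) (Sum.inr c) (Sum.inr d) = 2 := by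
  rw [numSPsg_of_common_neighbor (x := Sum.inl 0) (by simpa using hne) (by simp)
    (by simp) (by simp), Finset.card_filter, Fintype.sum_sum_type]
  simp

theorem numSPsgThrough_inl_inl {h k : Fin 2} (hne : h ≠ k) (c : Fin n) :
    numSPsgThrough (K2n n) (Sum.inr c) (Sum.inl h) (Sum.inl k) = 1 := by
  rw [numSPsgThrough_of_common_neighbor (x := Sum.inr c) (by simp) (by simp)
    (by simpa using hne) (by simp) (by simp) (by simp)]
  simp

theorem numSPsgThrough_inr_inr {c d : Fin n} (hne : c ≠ d) (h : Fin 2) :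
    numSPsgThrough (K2n n) (Sum.inl h) (Sum.inr c) (Sum.inr d) = 1 := by
  rw [numSPsgThrough_of_common_neighbor (x := Sum.inl h) (by simp) (by simp)
    (by simpa using hne) (by simp) (by simp) (by simp)]
  simp

theorem numSPsgThrough_inr_inr_inr {c d e : Fin n} (hec : e ≠ c) (hed : e ≠ d) (hne : c ≠ d) :
    numSPsgThrough (K2n n) (Sum.inr e) (Sum.inr c) (Sum.inr d) = 0 := by
  rw [numSPsgThrough_of_common_neighbor (x := Sum.inl 0) (by simpa using hec)
    (by simpa using hed) (by simpa using hne) (by simp) (by simp) (by simp)]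
  simp

/-- The dependency of a pair of vertices on a vertex of the part of size `n`. -/
theorem ratio_inr (hn : 1 ≤ n) (c : Fin n) (w u : Fin 2 ⊕ Fin n) :
    (if w ≠ Sum.inr c ∧ u ≠ Sum.inr c ∧ w ≠ u then
      (numSPsgThrough (K2n n) (Sum.inr c) w u : ℝ) / (numSPsg (K2n n) w u : ℝ) else 0) =
    if w.isLeft ∧ u.isLeft ∧ w ≠ u then 1 / (n : ℝ) else 0 := by
  by_cases hc : w ≠ Sum.inr c ∧ u ≠ Sum.inr c ∧ w ≠ u
  · rw [if_pos hc]
    obtain ⟨hw, hu, hne⟩ := hc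
    rcases w with h | d <;> rcases u with k | e
    · have hk : h ≠ k := by simpa using hne
      simp [numSPsgThrough_inl_inl hk, numSPsg_inl_inl hn hk, hk]
    · simp [numSPsgThrough_of_adj hw.symm hu.symm (adj_inl_inr h e)]
    · simp [numSPsgThrough_of_adj hw.symm hu.symm (adj_inr_inl k d)]
    · rw [numSPsgThrough_inr_inr_inr (by simpa using hw.symm) (by simpa using hu.symm)
        (by simpa using hne)]
      simp
  · rw [if_neg hc, if_neg]
    rintro ⟨hw, hu, hne⟩
    refine hc ⟨?_, ?_, hne⟩ <;> rintro rfl <;> simp_all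

/-- The dependency of a pair of vertices on a vertex of the part of size two. -/
theorem ratio_inl (h : Fin 2) (w u : Fin 2 ⊕ Fin n) :
    (if w ≠ Sum.inl h ∧ u ≠ Sum.inl h ∧ w ≠ u then
      (numSPsgThrough (K2n n) (Sum.inl h) w u : ℝ) / (numSPsg (K2n n) w u : ℝ) else 0) =
    if w.isRight ∧ u.isRight ∧ w ≠ u then 1 / (2 : ℝ) else 0 := by
  by_cases hc : w ≠ Sum.inl h ∧ u ≠ Sum.inl h ∧ w ≠ u
  · rw [if_pos hc]
    obtain ⟨hw, hu, hne⟩ := hc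
    rcases w with k | d <;> rcases u with l | e
    · simp only [ne_eq, Sum.inl.injEq] at hw hu hne
      omega
    · simp [numSPsgThrough_of_adj hw.symm hu.symm (adj_inl_inr k e)]
    · simp [numSPsgThrough_of_adj hw.symm hu.symm (adj_inr_inl l d)]
    · have hd : d ≠ e := by simpa using hne
      simp [numSPsgThrough_inr_inr hd, numSPsg_inr_inr hd, hd]
  · rw [if_neg hc, if_neg]
    rintro ⟨hw, hu, hne⟩
    refine hc ⟨?_, ?_, hne⟩ <;> rintro rfl <;> simp_all

theorem sum_sum_ne (m : ℕ) (a : ℝ) :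
    ∑ i : Fin m, ∑ j : Fin m, (if i = j then 0 else a) = ((m * (m - 1) : ℕ) : ℝ) * a := by
  have hi (i : Fin m) : ∑ j : Fin m, (if i = j then 0 else a) = ((m - 1 : ℕ) : ℝ) * a := by
    rw [Finset.sum_ite, Finset.sum_const_zero, zero_add, Finset.sum_const, nsmul_eq_mul,
      Finset.filter_ne]
    simp
  simp [hi, mul_assoc]

end K2n

/-- In `K_{2,n}`, every vertex `cᵢ` has betweenness centrality `1/n`, and
each of `h₁, h₂` has betweenness centrality `n(n-1)/4`. -/
theorem betweenness_K2n (n : ℕ) (hn : 1 ≤ n) :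
    (∀ c : Fin n, betwSG (K2n n) (Sum.inr c) = 1 / (n : ℝ)) ∧
    (∀ h : Fin 2, betwSG (K2n n) (Sum.inl h) = ((n * (n - 1) : ℕ) : ℝ) / 4) := by
  refine ⟨fun c => ?_, fun h => ?_⟩
  · have hsum : betwSG (K2n n) (Sum.inr c) = (1 / 2) * ∑ w : Fin 2 ⊕ Fin n,
        ∑ u : Fin 2 ⊕ Fin n, if w.isLeft ∧ u.isLeft ∧ w ≠ u then 1 / (n : ℝ) else 0 := by
      unfold betwSG
      refine congrArg _ (Finset.sum_congr rfl fun w _ => Finset.sum_congr rfl fun u _ => ?_)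
      convert K2n.ratio_inr hn c w u
    rw [hsum]
    simp only [Fintype.sum_sum_type]
    simp
    ring
  · have hsum : betwSG (K2n n) (Sum.inl h) = (1 / 2) * ∑ w : Fin 2 ⊕ Fin n,
        ∑ u : Fin 2 ⊕ Fin n, if w.isRight ∧ u.isRight ∧ w ≠ u then 1 / (2 : ℝ) else 0 := by
      unfold betwSG
      refine congrArg _ (Finset.sum_congr rfl fun w _ => Finset.sum_congr rfl fun u _ => ?_)
      convert K2n.ratio_inl h w u
    rw [hsum]
    simp only [Fintype.sum_sum_type]
    simp [K2n.sum_sum_ne]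
    ring
end

section
/- Let H be a simple graph (a single layer of a multilayer network) with vertex set V^α, let v̂ ∈ V^α be the evader, let d^α ∈ ℕ with 1 ≤ d^α ≤ |V^α \ {v̂}|, let δ^α be the d^α-th largest degree in H among the vertices of V^α \ {v̂}, let δ₀ be the degree of v̂ in H, and let q = |{v ∈ V^α \ {v̂} : deg_H(v) > δ^α}|. Let T be a set of vertices of V^α not adjacent to v̂ in H and with v̂ ∉ T, and let Ĥ be H with an edge from v̂ to each member of T added. Then at least d^α vertices of V^α have degree in Ĥ strictly greater than the degree of v̂ in Ĥ if and only if either |T| ≤ δ^α − 1 − δ₀, or |T| = δ^α − δ₀ and |{v ∈ T : deg_H(v) = δ^α}| ≥ d^α − q. -/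
open scoped Classical ENNReal

/-- The graph obtained from `H` by joining `ve` to every vertex of `T`. -/
private abbrev joinTo {V : Type*} (H : SimpleGraph V) (ve : V) (T : Finset V) : SimpleGraph V :=
  SimpleGraph.fromRel (fun a b => H.Adj a b ∨ (a = ve ∧ b ∈ T))

private lemma joinTo_ncard_neighborSet_self {V : Type*} [Fintype V] (H : SimpleGraph V) (ve : V)
    (T : Finset V) (hveT : ve ∉ T) (hTnadj : ∀ v ∈ T, ¬ H.Adj ve v) :
    ((joinTo H ve T).neighborSet ve).ncard = T.card + (H.neighborSet ve).ncard := by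
  have h : (joinTo H ve T).neighborSet ve = (T : Set V) ∪ H.neighborSet ve := by
    ext w
    have h1 : H.Adj ve w → ve ≠ w := fun h => h.ne
    have h2 := H.adj_comm ve w
    simp only [SimpleGraph.mem_neighborSet, SimpleGraph.fromRel_adj, Set.mem_union,
      Finset.mem_coe]
    grind
  rw [h, Set.ncard_union_eq, Set.ncard_coe_finset]
  exact Set.disjoint_left.2 fun v hv hv' => hTnadj v hv hv'

private lemma joinTo_ncard_neighborSet_of_mem {V : Type*} [Fintype V] (H : SimpleGraph V) (ve : V)
    (T : Finset V) (hveT : ve ∉ T) (hTnadj : ∀ v ∈ T, ¬ H.Adj ve v) {z : V} (hz : z ∈ T) :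
    ((joinTo H ve T).neighborSet z).ncard = (H.neighborSet z).ncard + 1 := by
  have h : (joinTo H ve T).neighborSet z = insert ve (H.neighborSet z) := by
    ext w
    have h1 : H.Adj z w → z ≠ w := fun h => h.ne
    have h2 := H.adj_comm z w
    simp only [SimpleGraph.mem_neighborSet, SimpleGraph.fromRel_adj, Set.mem_insert_iff]
    grind
  rw [h, Set.ncard_insert_of_notMem]
  exact fun h => hTnadj z hz h.symm

private lemma joinTo_ncard_neighborSet_of_notMem {V : Type*} (H : SimpleGraph V) (ve : V)
    (T : Finset V) {z : V} (hz : z ∉ T) (hne : z ≠ ve) :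
    ((joinTo H ve T).neighborSet z).ncard = (H.neighborSet z).ncard := by
  congr 1
  ext w
  have h1 : H.Adj z w → z ≠ w := fun h => h.ne
  have h2 := H.adj_comm z w
  simp only [SimpleGraph.mem_neighborSet, SimpleGraph.fromRel_adj]
  grind

/-- Characterization of the sets `T` of non-neighbours of the evader `ve`
that can be joined to `ve` in a single layer `H` while keeping at least `d` vertices of
strictly greater degree than `ve`. Here `δ` is the `d`-th largest degree among the vertices
other than `ve` (characterized by the two hypotheses `hδ₁`, `hδ₂`), `δ₀` is the degree of
`ve`, and `q` is the number of vertices other than `ve` of degree exceeding `δ`.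
(The inequality `|T| ≤ δ - 1 - δ₀` is stated subtraction-free as `|T| + δ₀ + 1 ≤ δ`, and
`|T| = δ - δ₀` as `|T| + δ₀ = δ`.) -/
theorem local_degree_hiding_single_layer_characterization
    {V : Type*} [Fintype V] (H : SimpleGraph V) (ve : V) (d : ℕ)
    (hd₁ : 1 ≤ d) (hd₂ : d ≤ ({v : V | v ≠ ve} : Set V).ncard)
    (δ δ₀ q : ℕ)
    (hδ₁ : d ≤ {v : V | v ≠ ve ∧ δ ≤ ((H.neighborSet v).ncard)}.ncard)
    (hδ₂ : {v : V | v ≠ ve ∧ δ < (H.neighborSet v).ncard}.ncard < d)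
    (hδ₀ : (H.neighborSet ve).ncard = δ₀)
    (hq : {v : V | v ≠ ve ∧ δ < (H.neighborSet v).ncard}.ncard = q)
    (T : Finset V) (hveT : ve ∉ T) (hTnadj : ∀ v ∈ T, ¬ H.Adj ve v) :
    (d ≤ {z : V |
        ((SimpleGraph.fromRel (fun a b => H.Adj a b ∨ (a = ve ∧ b ∈ T))).neighborSet ve).ncard <
        ((SimpleGraph.fromRel (fun a b => H.Adj a b ∨ (a = ve ∧ b ∈ T))).neighborSet z).ncard
        }.ncard)
    ↔ (T.card + δ₀ + 1 ≤ δ ∨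
        (T.card + δ₀ = δ ∧ d - q ≤ (T.filter (fun v => (H.neighborSet v).ncard = δ)).card)) := by
  have hself := joinTo_ncard_neighborSet_self H ve T hveT hTnadj
  have hset : {z : V | ((joinTo H ve T).neighborSet ve).ncard <
      ((joinTo H ve T).neighborSet z).ncard} =
      {z : V | z ≠ ve ∧ (T.card + δ₀ < (H.neighborSet z).ncard ∨
        (z ∈ T ∧ T.card + δ₀ = (H.neighborSet z).ncard))} := by
    ext z
    simp only [Set.mem_ofPred_eq]
    by_cases hz : z = ve
    · subst hz; simp
    by_cases hzT : z ∈ T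
    · rw [hself, joinTo_ncard_neighborSet_of_mem H ve T hveT hTnadj hzT]
      grind
    · rw [hself, joinTo_ncard_neighborSet_of_notMem H ve T hzT hz]
      grind
  rw [hset]
  rcases lt_trichotomy (T.card + δ₀) δ with h | h | h
  · refine iff_of_true (hδ₁.trans (Set.ncard_le_ncard ?_)) (Or.inl h)
    rintro z ⟨hz, hz'⟩
    exact ⟨hz, Or.inl (h.trans_le hz')⟩
  · have hunion : {z : V | z ≠ ve ∧ (T.card + δ₀ < (H.neighborSet z).ncard ∨
        (z ∈ T ∧ T.card + δ₀ = (H.neighborSet z).ncard))} =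
        {v : V | v ≠ ve ∧ δ < (H.neighborSet v).ncard} ∪
          (T.filter (fun v => (H.neighborSet v).ncard = δ) : Set V) := by
      ext z
      simp only [Set.mem_ofPred_eq, Set.mem_union, Finset.mem_coe, Finset.mem_filter]
      have hne : z ∈ T → z ≠ ve := fun hz e => hveT (e ▸ hz)
      rw [h, eq_comm (a := δ)]
      tauto
    rw [hunion, Set.ncard_union_eq, Set.ncard_coe_finset, hq]
    · lia
    · refine Set.disjoint_left.2 fun v hv hv' => ?_
      exact hv.2.ne' (Finset.mem_filter.1 hv').2
  · refine iff_of_false (fun hd => ?_) (by lia)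
    refine (hd.trans (Set.ncard_le_ncard ?_)).not_gt hδ₂
    rintro z ⟨hz, hz'⟩
    exact ⟨hz, by lia⟩
end
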